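/- Let X be a simple graph as in the context, let α = (M + √(M² + 4M))/2, and define bounded operators: B_m = C_m for m = 0,1,2 and B_m = C_m − (Q_X − I)·Σ_{j=1}^{⌊m/2⌋} C_{m−2j} for m ≥ 3; R_m = 0 for m = 0,1,2 and (R_m f)(x) = (Σ_{j=1}^{⌈m/2⌉−1} j·(Δ_X c_{m−2j})(x))·f(x) for m ≥ 3; R_m⁺ = 0 for m = 0,1,2 and R_m⁺ = (Q_X − I)·δ_{2ℤ}(m) + R_m for m ≥ 3 (δ_{2ℤ}(m) = 1 if m is even, 0 otherwise); and N_{X,m} = B_m + R_m⁺. Then for every complex number u with |u| < 1/α, I − uA_X + u²Q_X is invertible and Σ_{m=1}^{∞} N_{X,m} u^m = u(A_X − 2Q_X u)(I − uA_X + u²Q_X)^{−1} + (Q_X − I)·u²/(1−u²) + Σ_{m=3}^{∞} R_m u^m. -/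

import Mathlib

noncomputable section

/-- The Hilbert space `ℓ²(V)` of square-summable complex functions on `V`. -/
abbrev ℓ2 (V : Type) : Type := lp (fun _ : V => ℂ) 2

namespace SimpleGraph

variable {V : Type} (G : SimpleGraph V)

/-- The degree of a vertex. -/
def gdeg (v : V) : ℕ := Nat.card (G.neighborSet v)

/-- A geodesic (non-backtracking) path of length `m` in a simple graph,
encoded as its sequence of `m + 1` vertices. -/
def IsGeoPath {m : ℕ} (p : Fin (m + 1) → V) : Prop :=
  (∀ (i : ℕ) (h : i + 1 < m + 1), G.Adj (p ⟨i, by omega⟩) (p ⟨i + 1, h⟩)) ∧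
  (∀ (i : ℕ) (h : i + 2 < m + 1), p ⟨i + 2, h⟩ ≠ p ⟨i, by omega⟩)

/-- The number of geodesic loops (closed non-backtracking paths) of length `m`
at `x`. -/
def cLoop (m : ℕ) (x : V) : ℕ :=
  Nat.card {p : Fin (m + 1) → V // G.IsGeoPath p ∧ p 0 = x ∧ p (Fin.last m) = x}

/-- The formal combinatorial Laplacian applied to `cLoop m`:
`(Δ_X c_m)(x) = deg(x)·c_m(x) − Σ_{y ∼ x} c_m(y)`. -/
def lapc (m : ℕ) (x : V) : ℤ :=
  (G.gdeg x : ℤ) * G.cLoop m x - ∑ᶠ y ∈ G.neighborSet x, (G.cLoop m y : ℤ)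

/-- The defining property of the geodesic-path-counting operators `C_m` on
`ℓ²(V)`: `(C_m f)(x) = Σ_c f(t(c))`, the sum over all geodesic paths `c` of
length `m` starting at `x` (so `C₀ = I` and `C₁ = A_X`). -/
def IsGeoCountOp (C : ℕ → (ℓ2 V →L[ℂ] ℓ2 V)) : Prop :=
  ∀ (m : ℕ) (f : ℓ2 V) (x : V),
    C m f x =
      ∑ᶠ p : {p : Fin (m + 1) → V // G.IsGeoPath p ∧ p 0 = x}, f (p.1 (Fin.last m))

/-- The defining property of the adjacency operator on `ℓ²(V)`:
`(A f)(x) = Σ_{y ∼ x} f(y)`. -/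
def IsAdjOp (A : ℓ2 V →L[ℂ] ℓ2 V) : Prop :=
  ∀ (f : ℓ2 V) (x : V), A f x = ∑ᶠ y ∈ G.neighborSet x, f y

/-- The defining property of the valency operator on `ℓ²(V)`:
`(D f)(x) = deg(x)·f(x)`. -/
def IsValOp (D : ℓ2 V →L[ℂ] ℓ2 V) : Prop :=
  ∀ (f : ℓ2 V) (x : V), D f x = (G.gdeg x : ℂ) * f x

end SimpleGraph

/-- The sum of the terms of `C` at the earlier indices of the same parity:
`Σ_{j=1}^{⌊m/2⌋} C_{m-2j}`. -/
def lagSum {E : Type*} [AddCommMonoid E] (C : ℕ → E) (m : ℕ) : E :=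
  ∑ j ∈ Finset.Icc 1 (m / 2), C (m - 2 * j)

theorem lagSum_add_two {E : Type*} [AddCommMonoid E] (C : ℕ → E) (m : ℕ) :
    lagSum C (m + 2) = C m + lagSum C m := by
  unfold lagSum
  rw [show (m + 2) / 2 = m / 2 + 1 by omega, ← Finset.Ico_add_one_right_eq_Icc,
    Finset.sum_eq_sum_Ico_succ_bot (by omega), ← Finset.Ico_add_one_right_eq_Icc,
    ← Finset.sum_Ico_add' _ 1 (m / 2 + 1) 1]
  congr 1
  exact Finset.sum_congr rfl fun j _ => by congr 1; omega

theorem norm_lagSum_le {E : Type*} [SeminormedAddCommGroup E] {C : ℕ → E} {α : ℝ} (hα : 1 ≤ α)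
    (hC : ∀ m, ‖C m‖ ≤ α ^ m) (m : ℕ) : ‖lagSum C m‖ ≤ m * α ^ m := by
  unfold lagSum
  calc _ ≤ ∑ j ∈ Finset.Icc 1 (m / 2), α ^ m := norm_sum_le_of_le _ fun j _ =>
        (hC _).trans (pow_le_pow_right₀ hα (by omega))
    _ = (m / 2 : ℕ) * α ^ m := by simp
    _ ≤ _ := by gcongr; omega

theorem summable_pow_smul_of_norm_le {E : Type*} [NormedAddCommGroup E] [NormedSpace ℂ E]
    [CompleteSpace E] {F : ℕ → E} {α K : ℝ} (k : ℕ) (hα : 0 ≤ α)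
    {u : ℂ} (hu : ‖u‖ * α < 1) (hF : ∀ m, ‖F m‖ ≤ K * (m : ℝ) ^ k * α ^ m) :
    Summable fun m => u ^ m • F m := by
  refine Summable.of_norm_bounded
    ((summable_pow_mul_geometric_of_norm_lt_one (R := ℝ) k (r := ‖u‖ * α) ?_).mul_left K)
    fun m => ?_
  · rwa [Real.norm_of_nonneg (by positivity)]
  · rw [norm_smul, norm_pow, mul_pow]
    calc _ ≤ ‖u‖ ^ m * (K * (m : ℝ) ^ k * α ^ m) := by gcongr; exact hF m
      _ = _ := by ring

theorem tsum_eq_of_add_two {E : Type*} [NormedAddCommGroup E] {F : ℕ → E} (hF : Summable F) :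
    ∑' m, F m = F 0 + F 1 + ∑' m, F (m + 2) := by
  rw [← hF.sum_add_tsum_nat_add 2]; simp [Finset.sum_range_succ]

theorem norm_le_pow_of_recurrence {𝓐 : Type*} [NormedRing 𝓐] {A Q : 𝓐} {C : ℕ → 𝓐} {M α : ℝ}
    (h0 : C 0 = 1) (h1 : C 1 = A) (h2 : C 2 = A * A - (Q + 1))
    (h3 : ∀ m, C (m + 3) = A * C (m + 2) - Q * C (m + 1)) (hone : ‖(1 : 𝓐)‖ ≤ 1)
    (hA : ‖A‖ ≤ M) (hQ : ‖Q‖ ≤ M) (hQ1 : ‖Q + 1‖ ≤ M) (hα : α ^ 2 = M * α + M) (hα0 : 0 ≤ α) :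
    ∀ m, ‖C m‖ ≤ α ^ m := by
  have hM : 0 ≤ M := (norm_nonneg _).trans hA
  have hMα : M ≤ α := by nlinarith
  have key : ∀ m, ‖C m‖ ≤ α ^ m ∧ ‖C (m + 1)‖ ≤ α ^ (m + 1) ∧ ‖C (m + 2)‖ ≤ α ^ (m + 2) := by
    intro m
    induction m with
    | zero =>
      refine ⟨by simpa [h0], by simpa [h1] using hA.trans hMα, ?_⟩
      calc ‖C 2‖ ≤ ‖A‖ * ‖A‖ + ‖Q + 1‖ := by
            rw [h2]; exact (norm_sub_le _ _).trans (by gcongr; exact norm_mul_le _ _)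
        _ ≤ M * α + M := by gcongr; exact hA.trans hMα
        _ = _ := by rw [← hα]
    | succ m ih =>
      refine ⟨ih.2.1, ih.2.2, ?_⟩
      calc ‖C (m + 3)‖ ≤ ‖A‖ * ‖C (m + 2)‖ + ‖Q‖ * ‖C (m + 1)‖ := by
            rw [h3]
            exact (norm_sub_le _ _).trans (by gcongr <;> exact norm_mul_le _ _)
        _ ≤ M * α ^ (m + 2) + M * α ^ (m + 1) := by gcongr; exacts [ih.2.2, ih.2.1]
        _ = α ^ (m + 1) * (M * α + M) := by ring
        _ = _ := by rw [← hα]; ring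
  exact fun m => (key m).1

section

variable {𝓐 : Type*} [NormedRing 𝓐] [NormedAlgebra ℂ 𝓐]
  {A Q : 𝓐} {C : ℕ → 𝓐} {M α : ℝ} {u : ℂ}

theorem isUnit_one_sub_smul_add_smul [CompleteSpace 𝓐] (hA : ‖A‖ ≤ M) (hQ : ‖Q‖ ≤ M)
    (hα : α ^ 2 = M * α + M) (hα0 : 0 < α) (hu : ‖u‖ * α < 1) :
    IsUnit (1 - u • A + u ^ 2 • Q) := by
  have hM : 0 ≤ M := (norm_nonneg _).trans hA
  rw [show 1 - u • A + u ^ 2 • Q = 1 - (u • A - u ^ 2 • Q) by abel]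
  refine isUnit_one_sub_of_norm_lt_one ?_
  calc ‖u • A - u ^ 2 • Q‖ ≤ ‖u‖ * M + ‖u‖ ^ 2 * M := by
        refine (norm_sub_le _ _).trans ?_
        rw [norm_smul, norm_smul, norm_pow]
        gcongr
    _ < 1 := by
        have h : ‖u‖ < 1 / α := by rwa [lt_div_iff₀ hα0]
        have : 1 / α * M + (1 / α) ^ 2 * M = 1 := by field_simp; linarith
        have hM' : 0 < M := hM.lt_of_ne (by rintro rfl; simp at hα; exact hα0.ne' hα)
        rw [← this]
        gcongr

theorem one_sub_smul_add_smul_mul_tsum (h0 : C 0 = 1) (h1 : C 1 = A)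
    (h2 : C 2 = A * A - (Q + 1)) (h3 : ∀ m, C (m + 3) = A * C (m + 2) - Q * C (m + 1))
    (hs : Summable fun m => u ^ m • C m) :
    (1 - u • A + u ^ 2 • Q) * ∑' m, u ^ m • C m = (1 - u ^ 2) • (1 : 𝓐) := by
  set S := ∑' m, u ^ m • C m with hS
  have hs1 : Summable fun m => u ^ (m + 1) • C (m + 1) := (summable_nat_add_iff 1).2 hs
  have e1 : S = 1 + ∑' m, u ^ (m + 1) • C (m + 1) := by
    rw [hS, hs.tsum_eq_zero_add]; simp [h0]
  have e2 : S = 1 + u • A + ∑' m, u ^ (m + 2) • C (m + 2) := by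
    rw [hS, tsum_eq_of_add_two hs]; simp [h0, h1]
  have hrec : ∀ m, u ^ (m + 2) • C (m + 2) =
      u • (A * (u ^ (m + 1) • C (m + 1))) - u ^ 2 • (Q * (u ^ m • C m))
        - (if m = 0 then u ^ 2 • (1 : 𝓐) else 0) := by
    rintro (_ | m)
    · simp [h0, h1, h2, smul_smul, smul_sub, pow_two]; abel
    · simp only [h3, smul_sub, mul_smul_comm, smul_smul]; simp; ring_nf
  have hS1 : HasSum (fun m => u ^ (m + 1) • C (m + 1)) (S - 1) := by
    rw [e1, add_sub_cancel_left]; exact hs1.hasSum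
  have e3 : ∑' m, u ^ (m + 2) • C (m + 2) = u • (A * (S - 1)) - u ^ 2 • (Q * S)
      - u ^ 2 • (1 : 𝓐) := by
    rw [tsum_congr hrec]
    exact ((((hS1.mul_left A).const_smul u).sub
      ((hs.hasSum.mul_left Q).const_smul (u ^ 2))).sub (hasSum_ite_eq 0 (u ^ 2 • (1 : 𝓐)))).tsum_eq
  rw [e3] at e2
  have e4 : S - u • (A * S) + u ^ 2 • (Q * S) = (1 - u ^ 2) • (1 : 𝓐) := by
    conv_lhs => enter [1, 1]; rw [e2]
    rw [mul_sub, smul_sub, sub_smul, mul_one, one_smul]; abel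
  rw [← e4]; simp [add_mul, sub_mul]

theorem smul_eq_of_add_two_recurrence {E : Type*} [NormedAddCommGroup E] [NormedSpace ℂ E]
    {F H : ℕ → E} (h0 : H 0 = 0) (h1 : H 1 = 0) (hH : ∀ m, H (m + 2) = F m + H m)
    (hsF : Summable fun m => u ^ m • F m) (hsH : Summable fun m => u ^ m • H m) :
    (1 - u ^ 2) • ∑' m, u ^ m • H m = u ^ 2 • ∑' m, u ^ m • F m := by
  have e := tsum_eq_of_add_two hsH
  have : ∀ m, u ^ (m + 2) • H (m + 2) = u ^ 2 • (u ^ m • F m) + u ^ 2 • (u ^ m • H m) := by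
    intro m; rw [hH, smul_add, smul_smul, smul_smul]; ring_nf
  simp_rw [this] at e
  rw [((hsF.const_smul _).tsum_add (hsH.const_smul _)), hsF.tsum_const_smul,
    hsH.tsum_const_smul, h0, h1] at e
  rw [sub_smul, one_smul]
  nth_rw 1 [e]
  simp

theorem hasSum_ite_even_smul (hu : ‖u‖ < 1) (T : 𝓐) :
    HasSum (fun m : ℕ => u ^ (m + 1) • (if Even (m + 1) then T else 0))
      ((u ^ 2 / (1 - u ^ 2)) • T) := by
  have hu2 : ‖u ^ 2‖ < 1 := by rw [norm_pow]; exact pow_lt_one₀ (norm_nonneg _) hu two_ne_zero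
  have h : HasSum (fun k : ℕ => u ^ (2 * k + 2) • T) ((u ^ 2 / (1 - u ^ 2)) • T) := by
    have := ((hasSum_geometric_of_norm_lt_one hu2).mul_left (u ^ 2)).smul_const T
    rw [div_eq_mul_inv]
    convert this using 3 with k
    ring
  have hinj : Function.Injective fun k : ℕ => 2 * k + 1 := fun a b h => by simpa using h
  refine (hinj.hasSum_iff ?_).1 ?_
  · intro m hm
    rw [if_neg, smul_zero]
    rintro ⟨k, hk⟩
    exact hm ⟨k - 1, by simp; omega⟩
  · convert h using 2 with k
    simp only [Function.comp]
    rw [if_pos ⟨k + 1, by ring⟩]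

/-- The generating series of the modified path counts, for a sequence obeying the
non-backtracking recurrence. -/
theorem hasSum_geo_series [CompleteSpace 𝓐] (h0 : C 0 = 1) (h1 : C 1 = A)
    (h2 : C 2 = A * A - (Q + 1))
    (h3 : ∀ m, C (m + 3) = A * C (m + 2) - Q * C (m + 1)) (hCα : ∀ m, ‖C m‖ ≤ α ^ m)
    (hα1 : 1 ≤ α) (hu : ‖u‖ * α < 1) (hunit : IsUnit (1 - u • A + u ^ 2 • Q)) :
    HasSum (fun m => u ^ (m + 1) • (C (m + 1) - (Q - 1) * lagSum C (m + 1)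
        + if Even (m + 1) then Q - 1 else 0))
      (u • ((A - (2 * u) • Q) * Ring.inverse (1 - u • A + u ^ 2 • Q)) +
          (u ^ 2 / (1 - u ^ 2)) • (Q - 1)) := by
  have hu1 : ‖u‖ < 1 := (le_mul_of_one_le_right (norm_nonneg _) hα1).trans_lt hu
  have hu2 : 1 - u ^ 2 ≠ 0 := fun h => by
    have : ‖u‖ ^ 2 = 1 := by rw [← norm_pow, ← sub_eq_zero.1 h, norm_one]
    nlinarith [norm_nonneg u]
  have hα0 : 0 ≤ α := zero_le_one.trans hα1
  have hsC : Summable fun m => u ^ m • C m :=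
    summable_pow_smul_of_norm_le (K := 1) 0 hα0 hu (by simpa using hCα)
  have hsH : Summable fun m => u ^ m • lagSum C m :=
    summable_pow_smul_of_norm_le (K := 1) 1 hα0 hu (by simpa using norm_lagSum_le hα1 hCα)
  have hP := one_sub_smul_add_smul_mul_tsum h0 h1 h2 h3 hsC
  have hH := smul_eq_of_add_two_recurrence (u := u) (F := C) (by simp [lagSum]) (by simp [lagSum])
    (lagSum_add_two C) hsC hsH
  have hC1 := (hasSum_nat_add_iff' 1).2 hsC.hasSum
  have hH1 := (hasSum_nat_add_iff' 1).2 hsH.hasSum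
  set S := ∑' m, u ^ m • C m
  set L := ∑' m, u ^ m • lagSum C m
  have hinv : Ring.inverse (1 - u • A + u ^ 2 • Q) = (1 - u ^ 2)⁻¹ • S := by
    have : S = (1 - u ^ 2) • Ring.inverse (1 - u • A + u ^ 2 • Q) := by
      rw [← Ring.inverse_mul_cancel_left _ S hunit, hP, mul_smul_comm, mul_one]
    rw [this, smul_smul, inv_mul_cancel₀ hu2, one_smul]
  have hval : u • ((A - (2 * u) • Q) * Ring.inverse (1 - u • A + u ^ 2 • Q)) =
      S - 1 - (Q - 1) * L := by
    refine smul_right_injective 𝓐 hu2 ?_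
    simp only
    rw [smul_sub, smul_sub, ← hP, ← mul_smul_comm _ _ L, hH, hinv]
    simp only [sub_mul, add_mul, smul_mul_assoc, mul_smul_comm, one_mul, smul_sub]
    match_scalars <;> field_simp <;> ring
  rw [hval]
  have hsum := (hC1.sub (hH1.mul_left (Q - 1))).add (hasSum_ite_even_smul hu1 (Q - 1))
  simpa [h0, lagSum, smul_add, smul_sub, mul_smul_comm] using hsum

end

namespace SimpleGraph

variable {V : Type} {G : SimpleGraph V} {m : ℕ} {x y : V}

/-- The geodesic paths of length `m + 1` whose first two vertices are `x` and `y`. -/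
def geoPathsFrom (G : SimpleGraph V) (m : ℕ) (x y : V) : Set (Fin (m + 2) → V) :=
  {p | G.IsGeoPath p ∧ p 0 = x ∧ p 1 = y}

/-- The sum of `f` over the endpoints of the geodesic paths of length `m + 1` whose first two
vertices are `x` and `y`, computed recursively. -/
def geoSum (hfin : ∀ v, (G.neighborSet v).Finite) (f : V → ℂ) : ℕ → V → V → ℂ
  | 0, _, y => f y
  | m + 1, x, y => ∑ᶠ z ∈ G.neighborSet y \ {x}, geoSum hfin f m y z

theorem isGeoPath_one_iff {p : Fin 2 → V} : G.IsGeoPath p ↔ G.Adj (p 0) (p 1) := by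
  constructor
  · intro h; exact h.1 0 (by omega)
  · intro h
    refine ⟨fun i hi => ?_, fun i hi => by omega⟩
    obtain rfl : i = 0 := by omega
    exact h

theorem isGeoPath_cons_iff {q : Fin (m + 2) → V} :
    G.IsGeoPath (Fin.cons x q : Fin (m + 3) → V) ↔ G.Adj x (q 0) ∧ q 1 ≠ x ∧ G.IsGeoPath q := by
  constructor
  · intro h
    have h1 := h.1 0 (by omega)
    have h2 := h.2 0 (by omega)
    refine ⟨h1, h2, fun i hi => h.1 (i + 1) (by omega),
      fun i hi => h.2 (i + 1) (by omega)⟩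
  · rintro ⟨h1, h2, h3⟩
    refine ⟨fun i hi => ?_, fun i hi => ?_⟩
    · rcases i with _ | i
      · exact h1
      · exact h3.1 i (by omega)
    · rcases i with _ | i
      · exact h2
      · exact h3.2 i (by omega)

theorem geoPathsFrom_zero (h : G.Adj x y) : G.geoPathsFrom 0 x y = {![x, y]} := by
  ext p
  simp only [geoPathsFrom, Set.mem_ofPred_eq, isGeoPath_one_iff, Set.mem_singleton_iff]
  constructor
  · rintro ⟨-, h0, h1⟩
    ext i; fin_cases i
    exacts [h0, h1]
  · rintro rfl
    simpa using h

theorem geoPathsFrom_succ (h : G.Adj x y) :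
    G.geoPathsFrom (m + 1) x y =
      ⋃ z ∈ G.neighborSet y \ {x}, Fin.cons (α := fun _ : Fin (m + 3) => V) x ''
        G.geoPathsFrom m y z := by
  ext p
  induction p using Fin.consCases with
  | _ a q =>
  simp only [geoPathsFrom, Set.mem_ofPred_eq, isGeoPath_cons_iff, Set.mem_iUnion, Set.mem_image,
    Fin.cons_inj, Set.mem_sdiff, mem_neighborSet, Set.mem_singleton_iff]
  constructor
  · rintro ⟨⟨h1, h2, h3⟩, rfl, rfl⟩
    exact ⟨q 1, ⟨h3.1 0 (by omega), h2⟩, q, ⟨h3, rfl, rfl⟩, rfl, rfl⟩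
  · rintro ⟨z, ⟨h1, h2⟩, q', ⟨h3, h4, h5⟩, rfl, rfl⟩
    refine ⟨⟨h4 ▸ h, h5 ▸ h2, h3⟩, rfl, h4⟩

theorem geoPathsFrom_finite_and_finsum (hfin : ∀ v, (G.neighborSet v).Finite) (f : V → ℂ) (m : ℕ) :
    ∀ x y, G.Adj x y → (G.geoPathsFrom m x y).Finite ∧
      ∑ᶠ p ∈ G.geoPathsFrom m x y, f (p (Fin.last _)) = geoSum hfin f m x y := by
  induction m with
  | zero =>
    intro x y h
    rw [geoPathsFrom_zero h]
    exact ⟨Set.finite_singleton _, by rw [finsum_mem_singleton]; rfl⟩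
  | succ m ih =>
    intro x y h
    have hfin' : (G.neighborSet y \ {x}).Finite := (hfin y).sdiff
    have hf : ∀ z ∈ G.neighborSet y \ {x},
        (Fin.cons (α := fun _ : Fin (m + 3) => V) x '' G.geoPathsFrom m y z).Finite :=
      fun z hz => (ih y z hz.1).1.image _
    rw [geoPathsFrom_succ h]
    refine ⟨hfin'.biUnion hf, ?_⟩
    rw [finsum_mem_biUnion _ hfin' hf]
    · refine finsum_mem_congr rfl fun z hz => ?_
      rw [finsum_mem_image (Fin.cons_right_injective (α := fun _ : Fin (m + 3) => V) x).injOn, ← (ih y z hz.1).2]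
      rfl
    · intro z _ z' _ hzz'
      refine Set.disjoint_left.2 ?_
      rintro _ ⟨q, hq, rfl⟩ ⟨q', hq', he⟩
      obtain rfl := Fin.cons_right_injective (α := fun _ : Fin (m + 3) => V) x he
      exact hzz' (hq.2.2.symm.trans hq'.2.2)

theorem setOf_isGeoPath_zero (x : V) :
    {p : Fin 1 → V | G.IsGeoPath p ∧ p 0 = x} = {fun _ => x} := by
  ext p
  simp only [Set.mem_ofPred_eq, Set.mem_singleton_iff]
  constructor
  · rintro ⟨-, h⟩
    funext i
    rwa [Subsingleton.elim i 0]
  · rintro rfl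
    exact ⟨⟨fun i hi => by omega, fun i hi => by omega⟩, rfl⟩

theorem setOf_isGeoPath_succ (m : ℕ) (x : V) :
    {p : Fin (m + 2) → V | G.IsGeoPath p ∧ p 0 = x} =
      ⋃ y ∈ G.neighborSet x, G.geoPathsFrom m x y := by
  ext p
  simp only [geoPathsFrom, Set.mem_ofPred_eq, Set.mem_iUnion, mem_neighborSet]
  constructor
  · rintro ⟨h, rfl⟩
    exact ⟨p 1, h.1 0 (by omega), h, rfl, rfl⟩
  · rintro ⟨y, -, h, h0, -⟩
    exact ⟨h, h0⟩

theorem finite_setOf_isGeoPath (hfin : ∀ v, (G.neighborSet v).Finite) (m : ℕ) (x : V) :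
    {p : Fin (m + 1) → V | G.IsGeoPath p ∧ p 0 = x}.Finite := by
  cases m with
  | zero => rw [setOf_isGeoPath_zero]; exact Set.finite_singleton _
  | succ m =>
    rw [setOf_isGeoPath_succ]
    exact (hfin x).biUnion fun y hy => (geoPathsFrom_finite_and_finsum hfin 0 m x y hy).1

theorem finsum_isGeoPath_succ (hfin : ∀ v, (G.neighborSet v).Finite) (f : V → ℂ) (m : ℕ) (x : V) :
    ∑ᶠ p : {p : Fin (m + 2) → V // G.IsGeoPath p ∧ p 0 = x}, f (p.1 (Fin.last _)) =
      ∑ᶠ y ∈ G.neighborSet x, geoSum hfin f m x y := by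
  have h := finsum_set_coe_eq_finsum_mem (f := fun p : Fin (m + 2) → V => f (p (Fin.last _)))
    {p : Fin (m + 2) → V | G.IsGeoPath p ∧ p 0 = x}
  refine h.trans ?_
  rw [setOf_isGeoPath_succ, finsum_mem_biUnion _ (hfin x)
    fun y hy => (geoPathsFrom_finite_and_finsum hfin f m x y hy).1]
  · exact finsum_mem_congr rfl fun y hy => (geoPathsFrom_finite_and_finsum hfin f m x y hy).2
  · intro z _ z' _ hzz'
    refine Set.disjoint_left.2 fun q hq hq' => hzz' (hq.2.2.symm.trans hq'.2.2)

/-- Splitting off the backtracking continuation of an edge. -/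
theorem finsum_geoSum (hfin : ∀ v, (G.neighborSet v).Finite) (f : V → ℂ) (m : ℕ) (h : G.Adj x y) :
    ∑ᶠ z ∈ G.neighborSet y, geoSum hfin f m y z =
      geoSum hfin f m y x + geoSum hfin f (m + 1) x y := by
  rw [geoSum, ← finsum_mem_insert _ (by simp) (hfin y).sdiff, Set.insert_sdiff_singleton,
    Set.insert_eq_of_mem (show x ∈ G.neighborSet y from h.symm)]

theorem finsum_finsum_geoSum (hfin : ∀ v, (G.neighborSet v).Finite) (f : V → ℂ) (m : ℕ) (x : V) :
    ∑ᶠ y ∈ G.neighborSet x, ∑ᶠ z ∈ G.neighborSet y, geoSum hfin f m y z =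
      ∑ᶠ y ∈ G.neighborSet x, geoSum hfin f m y x +
        ∑ᶠ y ∈ G.neighborSet x, geoSum hfin f (m + 1) x y := by
  rw [← finsum_mem_add_distrib (hfin x)]
  exact finsum_mem_congr rfl fun y hy => finsum_geoSum hfin f m hy

theorem finsum_mem_neighborSet_const (hfin : ∀ v, (G.neighborSet v).Finite) (x : V) (c : ℂ) :
    ∑ᶠ _y ∈ G.neighborSet x, c = G.gdeg x * c := by
  rw [finsum_mem_eq_finite_toFinset_sum _ (hfin x), Finset.sum_const, nsmul_eq_mul, gdeg,
    Nat.card_coe_set_eq, Set.ncard_eq_toFinset_card _ (hfin x)]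

theorem finsum_geoSum_succ_backtrack (hfin : ∀ v, (G.neighborSet v).Finite) (f : V → ℂ) (m : ℕ)
    (x : V) : ∑ᶠ y ∈ G.neighborSet x, geoSum hfin f (m + 1) y x =
      (G.gdeg x - 1) * ∑ᶠ y ∈ G.neighborSet x, geoSum hfin f m x y := by
  have h : ∀ y ∈ G.neighborSet x, geoSum hfin f (m + 1) y x =
      ∑ᶠ z ∈ G.neighborSet x, geoSum hfin f m x z - geoSum hfin f m x y := fun y hy => by
    rw [finsum_geoSum hfin f m (show G.Adj y x from SimpleGraph.Adj.symm hy)]; ring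
  rw [finsum_mem_congr rfl h, finsum_mem_sub_distrib _ _ (hfin x), finsum_mem_neighborSet_const hfin]
  ring

end SimpleGraph

section Operators

variable {V : Type} {G : SimpleGraph V} {A D : ℓ2 V →L[ℂ] ℓ2 V} {C : ℕ → (ℓ2 V →L[ℂ] ℓ2 V)}

theorem ContinuousLinearMap.opNorm_le_of_norm_apply_le {T : ℓ2 V →L[ℂ] ℓ2 V} {r : ℝ} (hr : 0 ≤ r)
    (h : ∀ f x, ‖T f x‖ ≤ r * ‖f x‖) : ‖T‖ ≤ r := by
  refine T.opNorm_le_bound hr fun f => ?_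
  have := lp.norm_mono (p := 2) two_ne_zero (x := T f) (y := (r : ℂ) • f) fun i => by
    rw [lp.coeFn_smul, Pi.smul_apply, norm_smul, Complex.norm_of_nonneg hr]
    exact h f i
  refine this.trans ?_
  rw [norm_smul, Complex.norm_of_nonneg hr]

namespace SimpleGraph

theorem IsAdjOp.norm_le (hA : G.IsAdjOp A) (hfin : ∀ v, (G.neighborSet v).Finite) {M : ℕ}
    (hM : ∀ v, G.gdeg v ≤ M) : ‖A‖ ≤ M := by
  classical
  have hcard : ∀ v, (hfin v).toFinset.card ≤ M := fun v => by
    rw [← Set.ncard_eq_toFinset_card _ (hfin v), ← Nat.card_coe_set_eq]; exact hM v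
  refine A.opNorm_le_bound (by positivity) fun f => ?_
  refine lp.norm_le_of_forall_sum_le (by simp) (by positivity) fun s => ?_
  have hpt : ∀ x, ‖A f x‖ ^ 2 ≤ M * ∑ y ∈ (hfin x).toFinset, ‖f y‖ ^ 2 := fun x => by
    rw [hA, finsum_mem_eq_finite_toFinset_sum _ (hfin x)]
    calc _ ≤ (∑ y ∈ (hfin x).toFinset, ‖f y‖) ^ 2 := by gcongr; exact norm_sum_le _ _
      _ ≤ (hfin x).toFinset.card * ∑ y ∈ (hfin x).toFinset, ‖f y‖ ^ 2 :=
        sq_sum_le_card_mul_sum_sq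
      _ ≤ _ := by gcongr; exact hcard x
  have hf := lp.sum_rpow_le_norm_rpow (by simp) f (s.biUnion fun x => (hfin x).toFinset)
  simp only [ENNReal.toReal_ofNat, Real.rpow_ofNat] at hf ⊢
  calc ∑ x ∈ s, ‖A f x‖ ^ 2
      ≤ ∑ x ∈ s, M * ∑ y ∈ (hfin x).toFinset, ‖f y‖ ^ 2 := Finset.sum_le_sum fun x _ => hpt x
    _ = M * ∑ y ∈ s.biUnion fun x => (hfin x).toFinset,
          ∑ x ∈ s with x ∈ (hfin y).toFinset, ‖f y‖ ^ 2 := by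
        rw [← Finset.mul_sum]
        congr 1
        refine Finset.sum_comm' fun x y => ?_
        simp only [Set.Finite.mem_toFinset, mem_neighborSet, Finset.mem_filter, Finset.mem_biUnion]
        exact ⟨fun h => ⟨⟨h.1, h.2.symm⟩, x, h⟩, fun h => ⟨h.1.1, h.1.2.symm⟩⟩
    _ ≤ M * ∑ y ∈ s.biUnion fun x => (hfin x).toFinset, M * ‖f y‖ ^ 2 := by
        gcongr with y
        rw [Finset.sum_const, nsmul_eq_mul]
        gcongr
        exact (Finset.card_le_card fun x hx => (Finset.mem_filter.1 hx).2).trans (hcard y)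
    _ = M ^ 2 * ∑ y ∈ s.biUnion fun x => (hfin x).toFinset, ‖f y‖ ^ 2 := by
        rw [← Finset.mul_sum]; ring
    _ ≤ (M * ‖f‖) ^ 2 := by rw [mul_pow]; gcongr

theorem IsValOp.norm_le (hD : G.IsValOp D) {M : ℕ} (hM : ∀ v, G.gdeg v ≤ M) : ‖D‖ ≤ M :=
  D.opNorm_le_of_norm_apply_le (by positivity) fun f x => by
    rw [hD, norm_mul, Complex.norm_natCast]
    gcongr
    exact hM x

theorem IsValOp.sub_one_apply (hD : G.IsValOp D) (f : ℓ2 V) (x : V) :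
    (D - 1) f x = (G.gdeg x - 1) * f x := by
  rw [sub_mul, one_mul, ← hD]; rfl

theorem IsValOp.norm_sub_one_le (hD : G.IsValOp D) {M : ℕ} (hM : ∀ v, G.gdeg v ≤ M)
    (hM1 : 1 ≤ M) : ‖D - 1‖ ≤ M :=
  (D - 1).opNorm_le_of_norm_apply_le (by positivity) fun f x => by
    rw [hD.sub_one_apply, norm_mul]
    gcongr
    rw [show ((G.gdeg x : ℂ) - 1) = ((G.gdeg x - 1 : ℝ) : ℂ) by push_cast; rfl, Complex.norm_real,
      Real.norm_eq_abs, abs_le]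
    have h1 : (G.gdeg x : ℝ) ≤ M := by exact_mod_cast hM x
    have h2 : (1 : ℝ) ≤ M := by exact_mod_cast hM1
    have h3 : (0 : ℝ) ≤ G.gdeg x := by positivity
    constructor <;> linarith

namespace IsGeoCountOp

theorem apply_succ (hC : G.IsGeoCountOp C) (hfin : ∀ v, (G.neighborSet v).Finite) (m : ℕ)
    (f : ℓ2 V) (x : V) : C (m + 1) f x = ∑ᶠ y ∈ G.neighborSet x, geoSum hfin f m x y :=
  (hC _ _ _).trans (finsum_isGeoPath_succ hfin f m x)

theorem zero_eq_one (hC : G.IsGeoCountOp C) : C 0 = 1 := by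
  ext f x
  rw [hC]
  have h := finsum_set_coe_eq_finsum_mem (f := fun p : Fin 1 → V => f (p (Fin.last _)))
    {p : Fin 1 → V | G.IsGeoPath p ∧ p 0 = x}
  refine h.trans ?_
  rw [setOf_isGeoPath_zero, finsum_mem_singleton]
  rfl

theorem one_eq_adj (hC : G.IsGeoCountOp C) (hA : G.IsAdjOp A)
    (hfin : ∀ v, (G.neighborSet v).Finite) : C 1 = A := by
  ext f x
  rw [hC.apply_succ hfin, hA]
  rfl

theorem adj_mul (hC : G.IsGeoCountOp C) (hA : G.IsAdjOp A)
    (hfin : ∀ v, (G.neighborSet v).Finite) (m : ℕ) (f : ℓ2 V) (x : V) :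
    (A * C (m + 1)) f x = ∑ᶠ y ∈ G.neighborSet x, geoSum hfin f m y x + C (m + 2) f x := by
  rw [hC.apply_succ hfin, ← finsum_finsum_geoSum]
  exact (hA _ _).trans (finsum_mem_congr rfl fun y _ => hC.apply_succ hfin m f y)

theorem two_eq (hC : G.IsGeoCountOp C) (hA : G.IsAdjOp A) (hD : G.IsValOp D)
    (hfin : ∀ v, (G.neighborSet v).Finite) : C 2 = A * A - D := by
  rw [eq_sub_iff_add_eq']
  ext f x
  have h := hC.adj_mul hA hfin 0 f x
  rw [hC.one_eq_adj hA hfin] at h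
  rw [h]
  refine congrArg (· + C 2 f x) ?_
  exact (hD f x).trans (finsum_mem_neighborSet_const hfin x (f x)).symm

theorem add_three_eq (hC : G.IsGeoCountOp C) (hA : G.IsAdjOp A) (hD : G.IsValOp D)
    (hfin : ∀ v, (G.neighborSet v).Finite) (m : ℕ) :
    C (m + 3) = A * C (m + 2) - (D - 1) * C (m + 1) := by
  rw [eq_sub_iff_add_eq']
  ext f x
  rw [hC.adj_mul hA hfin, finsum_geoSum_succ_backtrack, ← hC.apply_succ hfin, ← hD.sub_one_apply]
  rfl

theorem cLoop_le_norm (hC : G.IsGeoCountOp C) (hfin : ∀ v, (G.neighborSet v).Finite) (m : ℕ)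
    (x : V) : (G.cLoop m x : ℝ) ≤ ‖C m‖ := by
  classical
  set e : ℓ2 V := lp.single 2 x (1 : ℂ)
  have he : ‖e‖ = 1 := by simp [e, lp.norm_single]
  have hval : C m e x = G.cLoop m x := by
    have := (finite_setOf_isGeoPath (G := G) hfin m x).fintype
    rw [hC, cLoop]
    change ∑ᶠ p : {p : Fin (m + 1) → V | G.IsGeoPath p ∧ p 0 = x}, e (p.1 (Fin.last m)) = _
    rw [finsum_eq_sum_of_fintype]
    have : ∀ p : {p : Fin (m + 1) → V | G.IsGeoPath p ∧ p 0 = x},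
        e (p.1 (Fin.last m)) = if p.1 (Fin.last m) = x then 1 else 0 := fun p => by
      simp [e, lp.single_apply, Pi.single_apply]
    simp_rw [this]
    rw [Finset.sum_boole, ← Fintype.card_subtype, ← Nat.card_eq_fintype_card]
    congr 1
    exact Nat.card_congr
      ⟨fun p => ⟨p.1.1, p.1.2.1, p.1.2.2, p.2⟩, fun p => ⟨⟨p.1, p.2.1, p.2.2.1⟩, p.2.2.2⟩,
        fun _ => rfl, fun _ => rfl⟩
  calc (G.cLoop m x : ℝ) = ‖C m e x‖ := by rw [hval, Complex.norm_natCast]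
    _ ≤ ‖C m e‖ := lp.norm_apply_le_norm two_ne_zero _ _
    _ ≤ ‖C m‖ := (C m).le_of_opNorm_le_of_le le_rfl he.le |>.trans_eq (mul_one _)

end IsGeoCountOp

theorem norm_lapc_le (hfin : ∀ v, (G.neighborSet v).Finite) {M : ℕ} (hM : ∀ v, G.gdeg v ≤ M)
    {m : ℕ} {r : ℝ} (hr : ∀ x, (G.cLoop m x : ℝ) ≤ r) (x : V) : ‖(G.lapc m x : ℂ)‖ ≤ M * r := by
  have hr0 : 0 ≤ r := (Nat.cast_nonneg _).trans (hr x)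
  have hMx : (G.gdeg x : ℝ) ≤ M := by exact_mod_cast hM x
  have h1 : (G.gdeg x : ℝ) * G.cLoop m x ≤ M * r := by gcongr; exact hr x
  have h2 : ((∑ᶠ y ∈ G.neighborSet x, (G.cLoop m y : ℤ) : ℤ) : ℝ) ≤ M * r := by
    rw [finsum_mem_eq_finite_toFinset_sum _ (hfin x)]
    push_cast
    refine (Finset.sum_le_card_nsmul _ _ r fun y _ => hr y).trans ?_
    rw [nsmul_eq_mul, ← Set.ncard_eq_toFinset_card _ (hfin x), ← Nat.card_coe_set_eq]
    gcongr
    exact hM x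
  have h3 : 0 ≤ ((∑ᶠ y ∈ G.neighborSet x, (G.cLoop m y : ℤ) : ℤ) : ℝ) := by
    exact_mod_cast finsum_nonneg fun y => finsum_nonneg fun _ => Int.natCast_nonneg _
  have h4 : (0 : ℝ) ≤ (G.gdeg x : ℝ) * G.cLoop m x := by positivity
  rw [Complex.norm_intCast, lapc]
  push_cast
  rw [abs_le]
  constructor <;> linarith

theorem norm_sum_mul_lapc_le (hfin : ∀ v, (G.neighborSet v).Finite) {M : ℕ}
    (hM : ∀ v, G.gdeg v ≤ M) {α : ℝ} (hα : 1 ≤ α) (hc : ∀ m x, (G.cLoop m x : ℝ) ≤ α ^ m)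
    (m n : ℕ) (hn : n ≤ m) (x : V) :
    ‖∑ j ∈ Finset.Icc 1 n, (j : ℂ) * (G.lapc (m - 2 * j) x : ℂ)‖ ≤ M * (m : ℝ) ^ 2 * α ^ m := by
  calc _ ≤ ∑ j ∈ Finset.Icc 1 n, (m : ℝ) * (M * α ^ m) := by
        refine norm_sum_le_of_le _ fun j hj => ?_
        rw [norm_mul, Complex.norm_natCast]
        have hj' : j ≤ m := (Finset.mem_Icc.1 hj).2.trans hn
        gcongr
        refine norm_lapc_le hfin hM (fun y => (hc _ y).trans ?_) x
        exact pow_le_pow_right₀ hα (by omega)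
    _ = n * (m * (M * α ^ m)) := by simp
    _ ≤ m * (m * (M * α ^ m)) := by gcongr
    _ = _ := by ring

end SimpleGraph

end Operators

/-- Part (2) of Proposition on `N_{X,m}`: with `B_m`, `R_m`, `R_m⁺` and
`N_{X,m} = B_m + R_m⁺` as in the paper, for `|u| < 1/α` the operator
`I − uA_X + u²Q_X` is invertible and
`Σ_{m≥1} N_{X,m} u^m = u(A_X − 2Q_X u)(I − uA_X + u²Q_X)^{−1}
  + (Q_X − I)u²/(1−u²) + Σ_{m≥3} R_m u^m`. -/
theorem N_op_series_identity {V : Type} (G : SimpleGraph V) [Countable V]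
    (hconn : G.Connected)
    (hfin : ∀ v : V, (G.neighborSet v).Finite)
    (hbd : ∃ M₀ : ℕ, ∀ v : V, G.gdeg v ≤ M₀)
    (hdeg1 : ∀ v : V, G.gdeg v ≠ 1)
    (M : ℕ) (hM : M = sSup (Set.range fun v : V => G.gdeg v))
    (A D : ℓ2 V →L[ℂ] ℓ2 V) (hA : G.IsAdjOp A) (hD : G.IsValOp D)
    (C : ℕ → (ℓ2 V →L[ℂ] ℓ2 V)) (hC : G.IsGeoCountOp C)
    (B : ℕ → (ℓ2 V →L[ℂ] ℓ2 V))
    (hB_small : ∀ m : ℕ, m ≤ 2 → B m = C m)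
    (hB : ∀ m : ℕ, 3 ≤ m →
      B m = C m - ((D - 1) - 1) * ∑ j ∈ Finset.Icc 1 (m / 2), C (m - 2 * j))
    (R : ℕ → (ℓ2 V →L[ℂ] ℓ2 V))
    (hR_small : ∀ m : ℕ, m ≤ 2 → R m = 0)
    (hR : ∀ m : ℕ, 3 ≤ m → ∀ (f : ℓ2 V) (x : V),
      R m f x =
        (∑ j ∈ Finset.Icc 1 ((m + 1) / 2 - 1), (j : ℂ) * (G.lapc (m - 2 * j) x : ℂ)) * f x)
    (Rp : ℕ → (ℓ2 V →L[ℂ] ℓ2 V))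
    (hRp_small : ∀ m : ℕ, m ≤ 2 → Rp m = 0)
    (hRp : ∀ m : ℕ, 3 ≤ m →
      Rp m = (if Even m then ((D - 1) - 1) else 0) + R m)
    (NX : ℕ → (ℓ2 V →L[ℂ] ℓ2 V)) (hNX : ∀ m : ℕ, NX m = B m + Rp m)
    (u : ℂ) (hu : ‖u‖ < 1 / (((M : ℝ) + Real.sqrt ((M : ℝ) ^ 2 + 4 * M)) / 2)) :
    IsUnit (1 - u • A + u ^ 2 • (D - 1)) ∧
      Summable (fun m : ℕ => u ^ (m + 1) • NX (m + 1)) ∧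
      Summable (fun m : ℕ => u ^ (m + 3) • R (m + 3)) ∧
      ∑' m : ℕ, u ^ (m + 1) • NX (m + 1) =
        u • ((A - (2 * u) • (D - 1)) * Ring.inverse (1 - u • A + u ^ 2 • (D - 1))) +
          (u ^ 2 / (1 - u ^ 2)) • ((D - 1) - 1) +
          ∑' m : ℕ, u ^ (m + 3) • R (m + 3) := by
  have hle : ∀ v, G.gdeg v ≤ M := fun v => by
    obtain ⟨M₀, hM₀⟩ := hbd
    rw [hM]
    exact le_csSup ⟨M₀, by rintro _ ⟨w, rfl⟩; exact hM₀ w⟩ ⟨v, rfl⟩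
  have hM1 : 1 ≤ M := by
    by_contra h
    obtain rfl : M = 0 := by omega
    simp at hu
    exact absurd hu (norm_nonneg u).not_gt
  set α : ℝ := ((M : ℝ) + Real.sqrt ((M : ℝ) ^ 2 + 4 * M)) / 2 with hαdef
  have hMR : (1 : ℝ) ≤ M := by exact_mod_cast hM1
  have hsq : Real.sqrt ((M : ℝ) ^ 2 + 4 * M) ^ 2 = (M : ℝ) ^ 2 + 4 * M :=
    Real.sq_sqrt (by positivity)
  have hαsq : α ^ 2 = M * α + M := by rw [hαdef]; linear_combination hsq / 4
  have hα1 : 1 ≤ α := by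
    have : (M : ℝ) ≤ Real.sqrt ((M : ℝ) ^ 2 + 4 * M) := Real.le_sqrt_of_sq_le (by linarith)
    rw [hαdef]; linarith
  have hα0 : 0 < α := one_pos.trans_le hα1
  have huα : ‖u‖ * α < 1 := (lt_div_iff₀ hα0).1 hu
  have hAM := hA.norm_le hfin hle
  have hQM := hD.norm_sub_one_le hle hM1
  have h0 := hC.zero_eq_one
  have h1 := hC.one_eq_adj hA hfin
  have h2 : C 2 = A * A - (D - 1 + 1) := by rw [sub_add_cancel]; exact hC.two_eq hA hD hfin
  have h3 := hC.add_three_eq hA hD hfin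
  have hCα : ∀ m, ‖C m‖ ≤ α ^ m :=
    norm_le_pow_of_recurrence h0 h1 h2 h3 ContinuousLinearMap.norm_id_le hAM hQM
      (by rw [sub_add_cancel]; exact hD.norm_le hle) hαsq hα0.le
  have hunit : IsUnit (1 - u • A + u ^ 2 • (D - 1)) :=
    isUnit_one_sub_smul_add_smul hAM hQM hαsq hα0 huα
  have hRα : ∀ m, ‖R m‖ ≤ M * (m : ℝ) ^ 2 * α ^ m := fun m => by
    rcases le_or_gt m 2 with hm | hm
    · rw [hR_small m hm, norm_zero]; positivity
    · refine (R m).opNorm_le_of_norm_apply_le (by positivity) fun f x => ?_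
      rw [hR m hm, norm_mul]
      gcongr
      exact SimpleGraph.norm_sum_mul_lapc_le hfin hle hα1
        (fun k y => (hC.cLoop_le_norm hfin k y).trans (hCα k)) m _ (by omega) x
  have hRs : Summable fun m => u ^ m • R m := summable_pow_smul_of_norm_le 2 hα0.le huα hRα
  have hR3 : Summable fun m => u ^ (m + 3) • R (m + 3) := (summable_nat_add_iff 3).2 hRs
  have hR1 : HasSum (fun m => u ^ (m + 1) • R (m + 1)) (∑' m, u ^ (m + 3) • R (m + 3)) := by
    refine (hasSum_nat_add_iff' 2).1 ?_
    simpa [Finset.sum_range_succ, hR_small] using hR3.hasSum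
  have hN : ∀ m, NX (m + 1) = (C (m + 1) - (D - 1 - 1) * lagSum C (m + 1)
      + if Even (m + 1) then D - 1 - 1 else 0) + R (m + 1) := fun m => by
    rcases m with _ | _ | m
    · simp [hNX, hB_small, hRp_small, hR_small, lagSum]
    · simp [hNX, hB_small, hRp_small, hR_small, lagSum, h0]
    · rw [hNX, hB _ (by omega), hRp _ (by omega), lagSum, ← add_assoc]
  have hsum := (hasSum_geo_series h0 h1 h2 h3 hCα hα1 huα hunit).add hR1
  simp_rw [← smul_add, ← hN] at hsum
  exact ⟨hunit, hsum.summable, hR3, hsum.tsum_eq⟩
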